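/- The theory T_OG has SOP₃ and is NSOP₄. -/

import Mathlib

open FirstOrder FirstOrder.Language Set Cardinal

universe u v w x

namespace PaperDiv

variable (L : FirstOrder.Language.{u, v}) (M : Type w) [L.Structure M]

/-- Two (possibly infinite) tuples have the same complete type over the parameter set `C`. -/
def SameType (C : Set M) {ι : Type x} (a b : ι → M) : Prop :=
  ∀ (n : ℕ) (φ : L.Formula (ι ⊕ Fin n)) (c : Fin n → M),
    (∀ i, c i ∈ C) → (φ.Realize (Sum.elim a c) ↔ φ.Realize (Sum.elim b c))

/-- The model-theoretic algebraic closure of a set `C`. -/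
def acl (C : Set M) : Set M :=
  {a | ∃ (n : ℕ) (φ : L.Formula (Fin (n + 1))) (c : Fin n → M),
    (∀ i, c i ∈ C) ∧ φ.Realize (Fin.cons a c) ∧ {x : M | φ.Realize (Fin.cons x c)}.Finite}

/-- A sequence of `ι`-tuples is indiscernible over `C`. -/
def Indiscernible (C : Set M) {ι : Type x} (b : ℕ → ι → M) : Prop :=
  ∀ (n : ℕ) (s t : Fin n → ℕ), StrictMono s → StrictMono t →
    SameType L M C (fun p : Fin n × ι => b (s p.1) p.2) (fun p : Fin n × ι => b (t p.1) p.2)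

/-- The formula `φ(x, b)` divides over `C`:  there is a `C`-indiscernible sequence starting
with `b` along which the instances of `φ` are `k`-inconsistent. -/
def FormulaDividesOver (C : Set M) {ι : Type x} {m : ℕ}
    (φ : L.Formula (ι ⊕ Fin m)) (b : Fin m → M) : Prop :=
  ∃ (bs : ℕ → Fin m → M) (k : ℕ), 0 < k ∧ bs 0 = b ∧ Indiscernible L M C bs ∧
    ∀ s : Finset ℕ, s.card = k → ¬∃ x : ι → M, ∀ i ∈ s, φ.Realize (Sum.elim x (bs i))

/-- The complete type of the tuple `a` over the parameter set `B` divides over `C`. -/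
def TypeDividesOver (C B : Set M) {ι : Type x} (a : ι → M) : Prop :=
  ∃ (m : ℕ) (φ : L.Formula (ι ⊕ Fin m)) (b : Fin m → M),
    (∀ i, b i ∈ B) ∧ φ.Realize (Sum.elim a b) ∧ FormulaDividesOver L M C φ b

/-- The complete type of the tuple `a` over the parameter set `B` forks over `C`: it implies a
finite disjunction of formulas (with arbitrary parameters), each of which divides over `C`. -/
def TypeForksOver (C B : Set M) {ι : Type x} (a : ι → M) : Prop :=
  ∃ (N : ℕ) (m : Fin N → ℕ) (φ : ∀ j, L.Formula (ι ⊕ Fin (m j))) (b : ∀ j, Fin (m j) → M),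
    (∀ j, FormulaDividesOver L M C (φ j) (b j)) ∧
    ∀ x : ι → M, SameType L M B x a → ∃ j, (φ j).Realize (Sum.elim x (b j))

/-- Dividing independence: `A ⫝d_C B`, i.e. `tp(A/BC)` does not divide over `C`. -/
def dind (A C B : Set M) : Prop :=
  ¬TypeDividesOver L M C (B ∪ C) (fun x : A => (x : M))

/-- Forking independence: `A ⫝f_C B`, i.e. `tp(A/BC)` does not fork over `C`. -/
def find (A C B : Set M) : Prop :=
  ¬TypeForksOver L M C (B ∪ C) (fun x : A => (x : M))

/-- Algebraic independence: `A ⫝a_C B`. -/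
def aind (A C B : Set M) : Prop :=
  acl L M (A ∪ C) ∩ acl L M (B ∪ C) = acl L M C

/-- M-independence: `A ⫝M_C B`. -/
def Mind (A C B : Set M) : Prop :=
  ∀ D : Set M, C ⊆ D → D ⊆ acl L M (B ∪ C) → aind L M A D B

/-- m-independence: `A ⫝m_C B`. -/
def mind (A C B : Set M) : Prop :=
  ∀ D : Set M, C ⊆ D → D ⊆ B ∪ C → aind L M A D B

/-- `M` is a monster model (with respect to the cardinal `κ` bounding the "small" sets):
it is strongly `κ`-homogeneous and `κ`-saturated. -/
structure IsMonster (κ : Cardinal.{w}) : Prop where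
  aleph0_lt : ℵ₀ < κ
  homogeneous : ∀ (C : Set M) {ι : Type w} (a b : ι → M), #C < κ → #ι < κ →
    SameType L M C a b → ∃ σ : M ≃[L] M, (∀ c ∈ C, σ c = c) ∧ ∀ i, σ (a i) = b i
  saturated : ∀ (C : Set M) {ι : Type w}, #C < κ → #ι < κ →
    ∀ p : Set ((n : ℕ) × L.Formula (ι ⊕ Fin n) × (Fin n → M)),
      (∀ q ∈ p, ∀ i, q.2.2 i ∈ C) →
      (∀ s : Finset ((n : ℕ) × L.Formula (ι ⊕ Fin n) × (Fin n → M)), ↑s ⊆ p →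
        ∃ x : ι → M, ∀ q ∈ s, q.2.1.Realize (Sum.elim x q.2.2)) →
      ∃ x : ι → M, ∀ q ∈ p, q.2.1.Realize (Sum.elim x q.2.2)


/-! ### The theory `T_OG` -/

/-- The relation symbols of the language `𝓛`: unary sort predicates `O`, `G`, `C`, a relation
`R` of type `G × G × C`, and a relation `E` of type `O × G × C`. -/
inductive RelOG : ℕ → Type
  | O : RelOG 1
  | G : RelOG 1
  | C : RelOG 1
  | R : RelOG 3
  | E : RelOG 3

/-- The constant symbols `0` and `1` (of sort `C`) of the language `𝓛'`. -/
inductive FnOG : ℕ → Type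
  | zero : FnOG 0
  | one : FnOG 0

/-- The language `𝓛'` (with the constants `0`, `1`). -/
abbrev LOG' : FirstOrder.Language := ⟨FnOG, RelOG⟩

/-- The language `𝓛 = 𝓛' ∖ {0, 1}`. -/
abbrev LOG : FirstOrder.Language := ⟨fun _ => Empty, RelOG⟩

/-- The inclusion of languages `𝓛 → 𝓛'`. -/
def redOG : LOG →ᴸ LOG' := ⟨fun {_} e => Empty.elim e, fun {_} r => r⟩

instance : Countable ((l : ℕ) × LOG'.Functions l) :=
  ⟨⟨fun x => match x with | ⟨_, FnOG.zero⟩ => 0 | ⟨_, FnOG.one⟩ => 1, by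
    rintro ⟨l₁, f₁⟩ ⟨l₂, f₂⟩ h
    cases f₁ <;> cases f₂
    · rfl
    · exact (Nat.zero_ne_one h).elim
    · exact (Nat.one_ne_zero h).elim
    · rfl⟩⟩

section
variable {S : Type*}

/-- The interpretation of the constant `0` in an `𝓛'`-structure. -/
def ogZero [LOG'.Structure S] : S := Structure.funMap (L := LOG') FnOG.zero ![]

/-- The interpretation of the constant `1` in an `𝓛'`-structure. -/
def ogOne [LOG'.Structure S] : S := Structure.funMap (L := LOG') FnOG.one ![]

/-- Sort `O` in an `𝓛'`-structure. -/
def sortO' [LOG'.Structure S] (x : S) : Prop := Structure.RelMap (L := LOG') RelOG.O ![x]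
/-- Sort `G` in an `𝓛'`-structure. -/
def sortG' [LOG'.Structure S] (x : S) : Prop := Structure.RelMap (L := LOG') RelOG.G ![x]
/-- Sort `C` in an `𝓛'`-structure. -/
def sortC' [LOG'.Structure S] (x : S) : Prop := Structure.RelMap (L := LOG') RelOG.C ![x]
/-- The relation `R` in an `𝓛'`-structure. -/
def relR' [LOG'.Structure S] (v w c : S) : Prop := Structure.RelMap (L := LOG') RelOG.R ![v, w, c]
/-- The relation `E` in an `𝓛'`-structure. -/
def relE' [LOG'.Structure S] (o v c : S) : Prop := Structure.RelMap (L := LOG') RelOG.E ![o, v, c]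

/-- Sort `O` in an `𝓛`-structure. -/
def sortO [LOG.Structure S] (x : S) : Prop := Structure.RelMap (L := LOG) RelOG.O ![x]
/-- Sort `G` in an `𝓛`-structure. -/
def sortG [LOG.Structure S] (x : S) : Prop := Structure.RelMap (L := LOG) RelOG.G ![x]
/-- Sort `C` in an `𝓛`-structure. -/
def sortC [LOG.Structure S] (x : S) : Prop := Structure.RelMap (L := LOG) RelOG.C ![x]
/-- The relation `R` in an `𝓛`-structure. -/
def relR [LOG.Structure S] (v w c : S) : Prop := Structure.RelMap (L := LOG) RelOG.R ![v, w, c]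
/-- The relation `E` in an `𝓛`-structure. -/
def relE [LOG.Structure S] (o v c : S) : Prop := Structure.RelMap (L := LOG) RelOG.E ![o, v, c]

/-- The defining conditions of the class `𝒦` (apart from finiteness): a three-sorted
structure (encoded with sort predicates) in which `0 ≠ 1` are the only elements of sort `C`,
`R(x,y,0)` and `R(x,y,1)` are disjoint graph relations on `G`, and whenever `R(v,w,c)` holds
there is no `o` of sort `O` with `E(o,v,c)` and `E(o,w,c)`. -/
def OGAxioms (S : Type*) [LOG'.Structure S] : Prop :=
  (∀ x : S, sortO' x ∨ sortG' x ∨ sortC' x) ∧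
  (∀ x : S, ¬(sortO' x ∧ sortG' x) ∧ ¬(sortO' x ∧ sortC' x) ∧ ¬(sortG' x ∧ sortC' x)) ∧
  (∀ v w c : S, relR' v w c → sortG' v ∧ sortG' w ∧ sortC' c) ∧
  (∀ o v c : S, relE' o v c → sortO' o ∧ sortG' v ∧ sortC' c) ∧
  (ogZero : S) ≠ ogOne ∧ sortC' (ogZero : S) ∧ sortC' (ogOne : S) ∧
  (∀ c : S, sortC' c → c = ogZero ∨ c = ogOne) ∧
  (∀ v w c : S, relR' v w c → relR' w v c) ∧
  (∀ v c : S, ¬relR' v v c) ∧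
  (∀ v w : S, ¬(relR' v w (ogZero : S) ∧ relR' v w (ogOne : S))) ∧
  (∀ v w c : S, relR' v w c → ¬∃ o : S, relE' o v c ∧ relE' o w c)

end

/-- The Fraïssé class `𝒦` of finite `𝓛'`-structures. -/
def KOG : Set (CategoryTheory.Bundled.{w} LOG'.Structure) :=
  {S | Finite S.α ∧ @OGAxioms S.α S.str}

/-- The theory `T_OG`: the complete theory of the reduct to `𝓛` of the Fraïssé limit of `𝒦`. -/
def TOG (M' : Type w) [LOG'.Structure M'] : LOG.Theory :=
  @FirstOrder.Language.completeTheory LOG M' (redOG.reduct M')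

/-- The theory of `M` has the `n`-strong order property `SOP_n` (for `n ≥ 1`): some formula
`φ(x̄, ȳ)` admits an infinite chain but no cycle of length `n`. -/
def HasSOP (L : FirstOrder.Language.{u, v}) (M : Type w) [L.Structure M] (n : ℕ) [NeZero n] :
    Prop :=
  ∃ (k : ℕ) (φ : L.Formula (Fin k ⊕ Fin k)),
    (∃ a : ℕ → Fin k → M, ∀ i j : ℕ, i < j → φ.Realize (Sum.elim (a i) (a j))) ∧
    ¬∃ c : Fin n → Fin k → M, ∀ i : Fin n, φ.Realize (Sum.elim (c i) (c (i + 1)))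

/-! ### Transfer of finite patterns between elementarily equivalent structures -/

section Patterns

variable {L M} {N : Type*} [L.Structure N]

/-- The sentence asserting the existence of a family of tuples such that `φ` holds for all pairs
of tuples whose indices are related by `r`. -/
noncomputable def patternSentence {k : ℕ} (φ : L.Formula (Fin k ⊕ Fin k)) {ι : Type} [Finite ι]
    (r : ι → ι → Prop) : L.Sentence :=
  Formula.iExs (ι × Fin k) (Formula.iInf fun p : {p : ι × ι // r p.1 p.2} =>
    φ.relabel (Sum.elim (fun s => Sum.inr (p.1.1, s)) fun s => Sum.inr (p.1.2, s)))

theorem realize_patternSentence {k : ℕ} (φ : L.Formula (Fin k ⊕ Fin k)) {ι : Type} [Finite ι]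
    (r : ι → ι → Prop) :
    M ⊨ patternSentence φ r ↔
      ∃ a : ι → Fin k → M, ∀ i j, r i j → φ.Realize (Sum.elim (a i) (a j)) := by
  have hcomp : ∀ (v : ι × Fin k → M) (i j : ι),
      (Sum.elim (default : Empty → M) v ∘
        Sum.elim (fun s => Sum.inr (i, s)) fun s => Sum.inr (j, s)) =
      Sum.elim (fun s => v (i, s)) fun s => v (j, s) := by
    intro v i j
    funext s
    rcases s with s | s <;> rfl
  simp only [patternSentence, Sentence.Realize, Formula.realize_iExs, Formula.realize_iInf,
    Formula.realize_relabel, hcomp]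
  constructor
  · rintro ⟨v, hv⟩
    exact ⟨fun i s => v (i, s), fun i j hij => hv ⟨(i, j), hij⟩⟩
  · rintro ⟨a, ha⟩
    exact ⟨fun q => a q.1 q.2, fun p => ha _ _ p.2⟩

/-- The existence of a finite configuration of tuples, certain pairs of which satisfy `φ`, is
invariant under elementary equivalence. -/
theorem exists_pattern_iff (h : ∀ σ : L.Sentence, N ⊨ σ ↔ M ⊨ σ) {k : ℕ}
    (φ : L.Formula (Fin k ⊕ Fin k)) {ι : Type} [Finite ι] (r : ι → ι → Prop) :
    (∃ a : ι → Fin k → N, ∀ i j, r i j → φ.Realize (Sum.elim (a i) (a j))) ↔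
      ∃ a : ι → Fin k → M, ∀ i j, r i j → φ.Realize (Sum.elim (a i) (a j)) := by
  rw [← realize_patternSentence, ← realize_patternSentence, h]

/-- In a monster model, arbitrarily long finite `φ`-chains yield an infinite one. -/
theorem IsMonster.exists_chain {κ : Cardinal.{w}} (hM : IsMonster L M κ) {k : ℕ}
    (φ : L.Formula (Fin k ⊕ Fin k))
    (h : ∀ n : ℕ, ∃ a : Fin n → Fin k → M,
      ∀ i j, i < j → φ.Realize (Sum.elim (a i) (a j))) :
    ∃ a : ℕ → Fin k → M, ∀ i j : ℕ, i < j → φ.Realize (Sum.elim (a i) (a j)) := by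
  classical
  let ι : Type w := ULift.{w} (ℕ × Fin k)
  let χ : ℕ → ℕ → (n : ℕ) × L.Formula (ι ⊕ Fin n) × (Fin n → M) := fun i j =>
    ⟨0, φ.relabel (Sum.elim (fun s => Sum.inl ⟨(i, s)⟩) fun s => Sum.inl ⟨(j, s)⟩), Fin.elim0⟩
  have hχ : ∀ (x : ι → M) (i j : ℕ),
      (χ i j).2.1.Realize (Sum.elim x (χ i j).2.2) ↔
        φ.Realize (Sum.elim (fun s => x ⟨(i, s)⟩) fun s => x ⟨(j, s)⟩) := by
    intro x i j
    simp only [χ, Formula.realize_relabel]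
    refine iff_of_eq (congrArg _ ?_)
    funext s
    rcases s with s | s <;> rfl
  obtain ⟨x, hx⟩ := hM.saturated ∅ (ι := ι) (by simpa using hM.aleph0_lt.trans_le' zero_le)
    ((Cardinal.mk_le_aleph0).trans_lt hM.aleph0_lt)
    {q | ∃ i j, i < j ∧ q = χ i j}
    (by
      rintro q ⟨i, j, -, rfl⟩ s
      exact s.elim0)
    (by
      intro s hs
      choose! f g hfg hq using fun q (hq : q ∈ s) => hs hq
      let n := s.sup g + 1
      obtain ⟨a, ha⟩ := h n
      refine ⟨fun p => a (Fin.ofNat n p.down.1) p.down.2, fun q hqs => ?_⟩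
      have hg : g q < n := Nat.lt_succ_of_le (Finset.le_sup hqs)
      rw [hq q hqs]
      refine (hχ _ _ _).2 (ha (Fin.ofNat n (f q)) (Fin.ofNat n (g q)) ?_)
      rw [Fin.lt_def]
      simp only [Fin.ofNat]
      rw [Nat.mod_eq_of_lt hg, Nat.mod_eq_of_lt ((hfg q hqs).trans hg)]
      exact hfg q hqs)
  exact ⟨fun i s => x ⟨(i, s)⟩, fun i j hij => (hχ x i j).1 (hx _ ⟨i, j, hij, rfl⟩)⟩

end Patterns

/-- Finite Ramsey theorem for triangles, with a bounded number of colours. -/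
theorem exists_monochromatic_triangle {γ : Type*} (m : ℕ) :
    ∃ n : ℕ, ∀ {α : Type} [LinearOrder α] (S : Finset α) (K : Finset γ) (col : α → α → γ),
      K.card ≤ m → n ≤ S.card → (∀ i ∈ S, ∀ j ∈ S, i < j → col i j ∈ K) →
      ∃ i j l, i < j ∧ j < l ∧ col i j = col i l ∧ col i j = col j l := by
  classical
  induction m with
  | zero =>
    refine ⟨2, fun S K col hK hS hcol => ?_⟩
    obtain ⟨i, hi, j, hj, hij⟩ := Finset.one_lt_card.1 hS
    have hK0 : K = ∅ := Finset.card_eq_zero.1 (Nat.le_zero.1 hK)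
    subst hK0
    rcases lt_or_gt_of_ne hij with hij | hij
    · exact absurd (hcol i hi j hj hij) (Finset.notMem_empty _)
    · exact absurd (hcol j hj i hi hij) (Finset.notMem_empty _)
  | succ m ih =>
    obtain ⟨n, hn⟩ := ih
    refine ⟨(m + 1) * n + 2, fun S K col hK hS hcol => ?_⟩
    have hne : S.Nonempty := Finset.card_pos.1 (by omega)
    set i := S.min' hne with hi_def
    have hi : i ∈ S := S.min'_mem hne
    have hlt : ∀ j ∈ S.erase i, i < j := fun j hj => S.min'_lt_of_mem_erase_min' hne hj
    obtain ⟨c, hcK, hc⟩ := Finset.exists_lt_card_fiber_of_mul_lt_card_of_maps_to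
      (s := S.erase i) (t := K) (f := col i) (n := n)
      (fun j hj => hcol i hi j (Finset.mem_of_mem_erase hj) (hlt j hj))
      (by
        rw [Finset.card_erase_of_mem hi]
        have := Nat.mul_le_mul_right n hK
        omega)
    by_cases hex : ∃ j l, j ∈ S.erase i ∧ col i j = c ∧ col i l = c ∧ j < l ∧ col j l = c
    · obtain ⟨j, l, hj, hj', hl, hjl, hc⟩ := hex
      exact ⟨i, j, l, hlt j hj, hjl, hj'.trans hl.symm, hj'.trans hc.symm⟩
    · refine hn ((S.erase i).filter fun j => col i j = c) (K.erase c) col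
        (by rw [Finset.card_erase_of_mem hcK]; omega) hc.le fun j hj l hl hjl => ?_
      rw [Finset.mem_filter] at hj hl
      refine Finset.mem_erase.2 ⟨fun h => hex ⟨j, l, hj.1, hj.2, hl.2, hjl, h⟩, ?_⟩
      exact hcol j (Finset.mem_of_mem_erase hj.1) l (Finset.mem_of_mem_erase hl.1) hjl

/-! ### Graph-theoretic description of the structures in `𝒦` -/

/-- The conditions defining `𝒦`, for a set with two distinguished points `κ`, two unary predicates
and two families of binary relations, the members of the families being indexed by `Bool`. -/
structure IsOGGraph {S : Type*} (κ : Bool → S) (O G : S → Prop) (R E : Bool → S → S → Prop) :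
    Prop where
  const_ne : κ false ≠ κ true
  cover : ∀ x, O x ∨ G x ∨ ∃ β, x = κ β
  not_O_and_G : ∀ x, ¬(O x ∧ G x)
  not_O_const : ∀ β, ¬O (κ β)
  not_G_const : ∀ β, ¬G (κ β)
  sort_R : ∀ β v w, R β v w → G v ∧ G w
  sort_E : ∀ β o v, E β o v → O o ∧ G v
  symm_R : ∀ β v w, R β v w → R β w v
  irrefl_R : ∀ β v, ¬R β v v
  disjoint_R : ∀ v w, ¬(R false v w ∧ R true v w)
  no_triangle : ∀ β o v w, R β v w → E β o v → ¬E β o w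

/-- The `𝓛'`-structure given by two constants, two sorts and two families of binary relations. -/
@[reducible] def ogStructure {S : Type*} (κ : Bool → S) (O G : S → Prop)
    (R E : Bool → S → S → Prop) : LOG'.Structure S where
  funMap := fun {_} f _ =>
    match f with
    | FnOG.zero => κ false
    | FnOG.one => κ true
  RelMap := fun {_} r =>
    match r with
    | RelOG.O => fun x => O (x 0)
    | RelOG.G => fun x => G (x 0)
    | RelOG.C => fun x => ∃ β, x 0 = κ β
    | RelOG.R => fun x => ∃ β, x 2 = κ β ∧ R β (x 0) (x 1)
    | RelOG.E => fun x => ∃ β, x 2 = κ β ∧ E β (x 0) (x 1)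

theorem IsOGGraph.injective {S : Type*} {κ : Bool → S} {O G : S → Prop}
    {R E : Bool → S → S → Prop} (h : IsOGGraph κ O G R E) : Function.Injective κ := by
  have := h.const_ne
  rintro (_ | _) (_ | _) hβ
  · rfl
  · exact absurd hβ this
  · exact absurd hβ.symm this
  · rfl

theorem IsOGGraph.ogAxioms {S : Type*} {κ : Bool → S} {O G : S → Prop}
    {R E : Bool → S → S → Prop} (h : IsOGGraph κ O G R E) :
    @OGAxioms S (ogStructure κ O G R E) := by
  let _ := ogStructure κ O G R E
  have hκ := h.injective
  refine ⟨h.cover, fun x => ⟨h.not_O_and_G x, ?_, ?_⟩, ?_, ?_, h.const_ne, ⟨false, rfl⟩,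
    ⟨true, rfl⟩, ?_, ?_, ?_, ?_, ?_⟩
  · rintro ⟨hO, β, hβ⟩
    change x = κ β at hβ
    subst hβ
    exact h.not_O_const β hO
  · rintro ⟨hG, β, hβ⟩
    change x = κ β at hβ
    subst hβ
    exact h.not_G_const β hG
  · rintro v w c ⟨β, hc, hR⟩
    exact ⟨(h.sort_R β v w hR).1, (h.sort_R β v w hR).2, β, hc⟩
  · rintro o v c ⟨β, hc, hE⟩
    exact ⟨(h.sort_E β o v hE).1, (h.sort_E β o v hE).2, β, hc⟩
  · rintro c ⟨_ | _, hc⟩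
    · exact Or.inl hc
    · exact Or.inr hc
  · rintro v w c ⟨β, hc, hR⟩
    exact ⟨β, hc, h.symm_R β v w hR⟩
  · rintro v c ⟨β, hc, hR⟩
    exact h.irrefl_R β v hR
  · rintro v w ⟨⟨β, hβ, hR⟩, ⟨β', hβ', hR'⟩⟩
    obtain rfl : false = β := hκ hβ
    obtain rfl : true = β' := hκ hβ'
    exact h.disjoint_R v w ⟨hR, hR'⟩
  · rintro v w c ⟨β, hc, hR⟩ ⟨o, ⟨β₁, h₁, hE₁⟩, ⟨β₂, h₂, hE₂⟩⟩
    obtain rfl : β = β₁ := hκ (hc.symm.trans h₁)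
    obtain rfl : β = β₂ := hκ (hc.symm.trans h₂)
    exact h.no_triangle β o v w hR hE₁ hE₂

/-- The two constants of an `𝓛'`-structure, as a family. -/
def ogConst {S : Type*} [LOG'.Structure S] (β : Bool) : S := if β then ogOne else ogZero

theorem OGAxioms.isOGGraph {S : Type*} [LOG'.Structure S] (h : OGAxioms S) :
    IsOGGraph (ogConst : Bool → S) sortO' sortG' (fun β v w => relR' v w (ogConst β))
      fun β o v => relE' o v (ogConst β) := by
  obtain ⟨h1, h2, h3, h4, h5, h6, h7, h8, h9, h10, h11, h12⟩ := h
  have hC : ∀ β, sortC' (ogConst β : S) := by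
    rintro (_ | _)
    · exact h6
    · exact h7
  refine ⟨h5, fun x => ?_, fun x => (h2 x).1, fun β hβ => (h2 _).2.1 ⟨hβ, hC β⟩,
    fun β hβ => (h2 _).2.2 ⟨hβ, hC β⟩, fun β v w hR => ⟨(h3 _ _ _ hR).1, (h3 _ _ _ hR).2.1⟩,
    fun β o v hE => ⟨(h4 _ _ _ hE).1, (h4 _ _ _ hE).2.1⟩, fun β v w => h9 v w _,
    fun β v => h10 v _, h11, fun β o v w hR hv hw => h12 v w _ hR ⟨o, hv, hw⟩⟩
  rcases h1 x with h | h | h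
  · exact Or.inl h
  · exact Or.inr (Or.inl h)
  · rcases h8 x h with h | h
    · exact Or.inr (Or.inr ⟨false, h⟩)
    · exact Or.inr (Or.inr ⟨true, h⟩)

/-- The relations of a structure satisfying the axioms of `𝒦` are those of its description as
a graph. -/
theorem OGAxioms.eq_ogStructure {S : Type*} {str : LOG'.Structure S} (h : OGAxioms S) :
    str = ogStructure ogConst sortO' sortG' (fun β v w => relR' v w (ogConst β))
      fun β o v => relE' o v (ogConst β) := by
  have hg := h.isOGGraph
  obtain ⟨h1, h2, h3, h4, h5, h6, h7, h8, h9, h10, h11, h12⟩ := h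
  have hC : ∀ c, sortC' (c : S) ↔ ∃ β, c = ogConst β := by
    intro c
    constructor
    · intro h
      rcases h8 c h with h | h
      · exact ⟨false, h⟩
      · exact ⟨true, h⟩
    · rintro ⟨_ | _, rfl⟩
      · exact h6
      · exact h7
  ext n f x
  · cases f
    · exact congrArg _ (Subsingleton.elim _ _)
    · exact congrArg _ (Subsingleton.elim _ _)
  · have e1 : ∀ y : Fin 1 → S, y = ![y 0] := fun y => by
      funext i; fin_cases i; rfl
    have e3 : ∀ y : Fin 3 → S, y = ![y 0, y 1, y 2] := fun y => by
      funext i; fin_cases i <;> rfl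
    cases f
    · rw [e1 x]; rfl
    · rw [e1 x]; rfl
    · rw [e1 x]; exact hC _
    · rw [e3 x]
      constructor
      · intro hR
        obtain ⟨β, hβ⟩ := (hC _).1 (h3 _ _ _ hR).2.2
        exact ⟨β, hβ, hβ ▸ hR⟩
      · rintro ⟨β, hβ, hR⟩
        change x 2 = _ at hβ
        rw [hβ]
        exact hR
    · rw [e3 x]
      constructor
      · intro hR
        obtain ⟨β, hβ⟩ := (hC _).1 (h4 _ _ _ hR).2.2
        exact ⟨β, hβ, hβ ▸ hR⟩
      · rintro ⟨β, hβ, hR⟩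
        change x 2 = _ at hβ
        rw [hβ]
        exact hR

theorem funMap_zero_eq {S : Type*} [LOG'.Structure S] (x : Fin 0 → S) :
    Structure.funMap (L := LOG') FnOG.zero x = ogConst false :=
  congrArg _ (Subsingleton.elim _ _)

theorem funMap_one_eq {S : Type*} [LOG'.Structure S] (x : Fin 0 → S) :
    Structure.funMap (L := LOG') FnOG.one x = ogConst true :=
  congrArg _ (Subsingleton.elim _ _)

section Embedding

variable {S T : Type*} [LOG'.Structure S] [LOG'.Structure T] (f : S ↪[LOG'] T)

theorem map_sortO' (x : S) : sortO' (f x) ↔ sortO' x :=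
  (iff_of_eq (congrArg _ (funext fun i => by fin_cases i; rfl))).trans (f.map_rel RelOG.O ![x])

theorem map_sortG' (x : S) : sortG' (f x) ↔ sortG' x :=
  (iff_of_eq (congrArg _ (funext fun i => by fin_cases i; rfl))).trans (f.map_rel RelOG.G ![x])

theorem map_sortC' (x : S) : sortC' (f x) ↔ sortC' x :=
  (iff_of_eq (congrArg _ (funext fun i => by fin_cases i; rfl))).trans (f.map_rel RelOG.C ![x])

theorem map_relR' (x y z : S) : relR' (f x) (f y) (f z) ↔ relR' x y z :=
  (iff_of_eq (congrArg _ (funext fun i => by fin_cases i <;> rfl))).trans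
    (f.map_rel RelOG.R ![x, y, z])

theorem map_relE' (x y z : S) : relE' (f x) (f y) (f z) ↔ relE' x y z :=
  (iff_of_eq (congrArg _ (funext fun i => by fin_cases i <;> rfl))).trans
    (f.map_rel RelOG.E ![x, y, z])

theorem map_ogZero : f ogZero = ogZero :=
  (f.map_fun FnOG.zero ![]).trans (funMap_zero_eq _)

theorem map_ogOne : f ogOne = ogOne :=
  (f.map_fun FnOG.one ![]).trans (funMap_one_eq _)

theorem map_ogConst (β : Bool) : f (ogConst β) = ogConst β := by
  cases β
  · exact map_ogZero f
  · exact map_ogOne f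

end Embedding

section Limit

variable {FM : Type w} [LOG'.Structure FM] [Countable FM]

/-- The Fraïssé limit of `𝒦` satisfies the (universal) axioms of `𝒦`. -/
theorem ogAxioms_of_isFraisseLimit (hlim : IsFraisseLimit KOG FM) : OGAxioms FM := by
  have hS : ∀ x y z t : FM, ∃ (S : LOG'.Substructure FM) (x' y' z' t' : S),
      OGAxioms (S : Type w) ∧ x = S.subtype x' ∧ y = S.subtype y' ∧ z = S.subtype z' ∧
        t = S.subtype t' := by
    intro x y z t
    let S : LOG'.Substructure FM := Substructure.closure LOG' {x, y, z, t}
    have hfg : S.FG := Substructure.fg_closure (by simp)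
    have hmem : (⟨S, inferInstance⟩ : CategoryTheory.Bundled.{w} LOG'.Structure) ∈ LOG'.age FM :=
      ⟨(Substructure.fg_iff_structure_fg S).1 hfg, ⟨S.subtype⟩⟩
    rw [hlim.age] at hmem
    have hsub : ({x, y, z, t} : Set FM) ⊆ S := Substructure.subset_closure
    exact ⟨S, ⟨x, hsub (by simp)⟩, ⟨y, hsub (by simp)⟩, ⟨z, hsub (by simp)⟩,
      ⟨t, hsub (by simp)⟩, hmem.2, rfl, rfl, rfl, rfl⟩
  refine ⟨fun x => ?_, fun x => ?_, fun v w c => ?_, fun v w c => ?_, ?_, ?_, ?_, fun x => ?_,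
    fun v w c => ?_, fun v c => ?_, fun v w => ?_, ?_⟩
  · obtain ⟨S, x, -, -, -, h, rfl, -⟩ := hS x x x x
    simpa only [map_sortO', map_sortG', map_sortC'] using h.1 x
  · obtain ⟨S, x, -, -, -, h, rfl, -⟩ := hS x x x x
    simpa only [map_sortO', map_sortG', map_sortC'] using h.2.1 x
  · obtain ⟨S, v, w, c, -, h, rfl, rfl, rfl, -⟩ := hS v w c c
    simpa only [map_sortO', map_sortG', map_sortC', map_relR'] using h.2.2.1 v w c
  · obtain ⟨S, v, w, c, -, h, rfl, rfl, rfl, -⟩ := hS v w c c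
    simpa only [map_sortO', map_sortG', map_sortC', map_relE'] using h.2.2.2.1 v w c
  · obtain ⟨S, -, -, -, -, h, -⟩ := hS ogZero ogZero ogZero ogZero
    rw [← map_ogZero S.subtype, ← map_ogOne S.subtype]
    exact fun he => h.2.2.2.2.1 (S.subtype.injective he)
  · obtain ⟨S, -, -, -, -, h, -⟩ := hS ogZero ogZero ogZero ogZero
    rw [← map_ogZero S.subtype, map_sortC']
    exact h.2.2.2.2.2.1
  · obtain ⟨S, -, -, -, -, h, -⟩ := hS ogZero ogZero ogZero ogZero
    rw [← map_ogOne S.subtype, map_sortC']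
    exact h.2.2.2.2.2.2.1
  · obtain ⟨S, x, -, -, -, h, rfl, -⟩ := hS x x x x
    rw [← map_ogZero S.subtype, ← map_ogOne S.subtype, map_sortC']
    intro hx
    exact (h.2.2.2.2.2.2.2.1 x hx).imp (congrArg _) (congrArg _)
  · obtain ⟨S, v, w, c, -, h, rfl, rfl, rfl, -⟩ := hS v w c c
    simpa only [map_relR'] using h.2.2.2.2.2.2.2.2.1 v w c
  · obtain ⟨S, v, c, -, -, h, rfl, rfl, -⟩ := hS v c c c
    simpa only [map_relR'] using h.2.2.2.2.2.2.2.2.2.1 v c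
  · obtain ⟨S, v, w, -, -, h, rfl, rfl, -⟩ := hS v w w w
    rw [← map_ogZero S.subtype, ← map_ogOne S.subtype, map_relR', map_relR']
    exact h.2.2.2.2.2.2.2.2.2.2.1 v w
  · rintro v w c hR ⟨o, hv, hw⟩
    obtain ⟨S, v, w, c, o, h, rfl, rfl, rfl, rfl⟩ := hS v w c o
    rw [map_relR'] at hR
    rw [map_relE'] at hv hw
    exact h.2.2.2.2.2.2.2.2.2.2.2 v w c hR ⟨o, hv, hw⟩

/-- Every finite structure described by a graph as in `IsOGGraph` is realized in the Fraïssé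
limit of `𝒦`. -/
theorem exists_realization (hlim : IsFraisseLimit KOG FM) {D : Type w} [Finite D]
    {κ : Bool → D} {O G : D → Prop} {R E : Bool → D → D → Prop} (h : IsOGGraph κ O G R E) :
    ∃ e : D → FM, Function.Injective e ∧ (∀ β, e (κ β) = ogConst β) ∧
      (∀ x, sortO' (e x) ↔ O x) ∧ (∀ x, sortG' (e x) ↔ G x) ∧
      (∀ β x y, relR' (e x) (e y) (ogConst β) ↔ R β x y) ∧
      ∀ β x y, relE' (e x) (e y) (ogConst β) ↔ E β x y := by
  let str := ogStructure κ O G R E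
  have hmem : (⟨D, str⟩ : CategoryTheory.Bundled LOG'.Structure) ∈ LOG'.age FM := by
    rw [hlim.age]
    exact ⟨‹Finite D›, h.ogAxioms⟩
  obtain ⟨-, ⟨e⟩⟩ := hmem
  change D ↪[LOG'] FM at e
  have hκ : ∀ β, (ogConst β : D) = κ β := by rintro (_ | _) <;> rfl
  refine ⟨e, e.injective, fun β => ?_, map_sortO' e, map_sortG' e, fun β x y => ?_,
    fun β x y => ?_⟩
  · rw [← hκ, map_ogConst]
  · rw [← map_ogConst e, map_relR', hκ]
    constructor
    · rintro ⟨β', hβ, hR⟩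
      obtain rfl := h.injective hβ
      exact hR
    · exact fun hR => ⟨β, rfl, hR⟩
  · rw [← map_ogConst e, map_relE', hκ]
    constructor
    · rintro ⟨β', hβ, hR⟩
      obtain rfl := h.injective hβ
      exact hR
    · exact fun hR => ⟨β, rfl, hR⟩

/-- Two finite tuples with the same quantifier-free type in the Fraïssé limit of `𝒦` are
conjugate. -/
theorem exists_automorphism (hlim : IsFraisseLimit KOG FM) {ι : Type*} [Finite ι]
    (u v : ι → FM) (hconst : ∀ β, ∃ p, u p = ogConst β ∧ v p = ogConst β)
    (heq : ∀ p q, u p = u q ↔ v p = v q) (hO : ∀ p, sortO' (u p) ↔ sortO' (v p))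
    (hG : ∀ p, sortG' (u p) ↔ sortG' (v p))
    (hR : ∀ β p q, relR' (u p) (u q) (ogConst β) ↔ relR' (v p) (v q) (ogConst β))
    (hE : ∀ β p q, relE' (u p) (u q) (ogConst β) ↔ relE' (v p) (v q) (ogConst β)) :
    ∃ σ : FM ≃[LOG'] FM, ∀ p, σ (u p) = v p := by
  have hax := ogAxioms_of_isFraisseLimit hlim
  let S : LOG'.Substructure FM :=
    { carrier := Set.range u
      fun_mem := by
        intro n f x _
        cases f
        · obtain ⟨p, hp, -⟩ := hconst false
          exact ⟨p, hp.trans (funMap_zero_eq x).symm⟩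
        · obtain ⟨p, hp, -⟩ := hconst true
          exact ⟨p, hp.trans (funMap_one_eq x).symm⟩ }
  have hfin : Finite S := Set.finite_coe_iff.2 (Set.finite_range u)
  choose g hg using fun x : S => x.2
  have hc : ∀ p β, u p = ogConst β ↔ v p = ogConst β := by
    intro p β
    obtain ⟨q, hq, hq'⟩ := hconst β
    rw [← hq, heq, hq, hq']
  have hMs := hax.eq_ogStructure
  have hrel : ∀ {n} (r : LOG'.Relations n) (x : Fin n → ι),
      Structure.RelMap r (fun i => v (x i)) ↔ Structure.RelMap r (fun i => u (x i)) := by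
    intro n r x
    rw [hMs]
    cases r
    · exact (hO _).symm
    · exact (hG _).symm
    · exact exists_congr fun β => (hc _ β).symm
    · exact exists_congr fun β => and_congr (hc _ β).symm (hR β _ _).symm
    · exact exists_congr fun β => and_congr (hc _ β).symm (hE β _ _).symm
  let f : S ↪[LOG'] FM :=
    { toFun := fun x => v (g x)
      inj' := fun x y hxy => Subtype.ext (by rw [← hg x, ← hg y]; exact (heq _ _).2 hxy)
      map_fun' := by
        intro n f x
        cases f
        · exact ((hc (g (Structure.funMap (L := LOG') FnOG.zero x)) false).1
            ((hg _).trans (funMap_zero_eq _))).trans (funMap_zero_eq _).symm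
        · exact ((hc (g (Structure.funMap (L := LOG') FnOG.one x)) true).1
            ((hg _).trans (funMap_one_eq _))).trans (funMap_one_eq _).symm
      map_rel' := by
        intro n r x
        refine (hrel r fun i => g (x i)).trans (iff_of_eq ?_)
        exact congrArg (Structure.RelMap r) (funext fun i => hg (x i)) }
  obtain ⟨σ, hσ⟩ := hlim.ultrahomogeneous S Substructure.FG.of_finite f
  refine ⟨σ, fun p => ?_⟩
  have h1 : f ⟨u p, p, rfl⟩ = σ (u p) := by rw [hσ]; rfl
  rw [← h1]
  exact (heq _ _).1 (hg ⟨u p, p, rfl⟩)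


end Limit

/-! ### Closing a pair of conjugate tuples up to a cycle of length four -/

/-- The tags `none`, `some i`, `some (i + 1)` of the points of the `i`-th piece of a cycle of
length four. -/
def InPiece (i : Fin 4) (τ : Option (Fin 4)) : Prop := τ = none ∨ τ = some i ∨ τ = some (i + 1)

instance (i : Fin 4) (τ : Option (Fin 4)) : Decidable (InPiece i τ) :=
  inferInstanceAs (Decidable (_ ∨ _ ∨ _))

theorem fin_four_ne : ∀ i : Fin 4, i ≠ i + 1 ∧ i ≠ i + 1 + 1 := by
  decide

set_option synthInstance.maxHeartbeats 200000 in
set_option synthInstance.maxSize 1000 in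
theorem exists_common_piece : ∀ τ₁ τ₂ τ₃ : Option (Fin 4), (∃ i, InPiece i τ₁ ∧ InPiece i τ₂) →
    (∃ i, InPiece i τ₁ ∧ InPiece i τ₃) → (∃ i, InPiece i τ₂ ∧ InPiece i τ₃) →
    ∃ i, InPiece i τ₁ ∧ InPiece i τ₂ ∧ InPiece i τ₃ := by
  decide

theorem inPiece_inter : ∀ (i j : Fin 4) (τ : Option (Fin 4)), InPiece i τ → InPiece j τ →
    i = j ∨ τ = none ∨ (j = i + 1 ∧ τ = some j) ∨ (i = j + 1 ∧ τ = some i) := by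
  decide

theorem inPiece_pair : ∀ (i j : Fin 4), i = j ∨ j = i + 1 ∨ i = j + 1 ∨
    ∀ τ, InPiece i τ → InPiece j τ → τ = none := by
  decide

/-- The identification of the `i`-th piece of the cycle with a subset of `S`: the points tagged
`i + 1` are moved by `θ`. -/
def unfoldPiece {S : Type*} (θ : S → S) (i : Fin 4) (p : S × Option (Fin 4)) : S :=
  if p.2 = some (i + 1) then θ p.1 else p.1

/-- The binary relation on the cycle which restricts to a copy of `P` on each of the four pieces
and does not relate points which are in no common piece. -/
def cycleRel {S : Type*} (θ : S → S) (P : S → S → Prop) (p q : S × Option (Fin 4)) : Prop :=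
  ∃ i, InPiece i p.2 ∧ InPiece i q.2 ∧ P (unfoldPiece θ i p) (unfoldPiece θ i q)

section Cycle

variable {S : Type*} {A : Set S} {θ : S → S}

/-- The points of the cycle built from `A` and `θ`: a fixed point of `θ` in `A` appears once, and
every other element of `A` appears four times. -/
def cyclePoints (A : Set S) (θ : S → S) : Set (S × Option (Fin 4)) :=
  {p | p.1 ∈ A ∧ (p.2 = none ↔ θ p.1 = p.1)}

theorem unfoldPiece_succ {p : S × Option (Fin 4)} (hp : p ∈ cyclePoints A θ) {i : Fin 4}
    (h : InPiece i p.2) (h' : InPiece (i + 1) p.2) :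
    unfoldPiece θ i p = θ (unfoldPiece θ (i + 1) p) ∧ unfoldPiece θ (i + 1) p ∈ A := by
  obtain ⟨x, τ⟩ := p
  have hi : i + 1 ≠ i + 1 + 1 := (fin_four_ne (i + 1)).1
  rcases inPiece_inter _ _ _ h h' with h0 | h0 | ⟨-, h0⟩ | ⟨h0, -⟩
  · exact absurd h0 (fin_four_ne i).1
  · have := hp.2.1 h0
    change τ = none at h0
    subst h0
    exact ⟨by simpa [unfoldPiece] using this.symm, by simpa [unfoldPiece] using hp.1⟩
  · change τ = some (i + 1) at h0
    subst h0
    simp only [unfoldPiece, Option.some.injEq, hi, if_true, if_false]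
    exact ⟨trivial, hp.1⟩
  · exact absurd h0 (fin_four_ne i).2

theorem cycleRel_iff {P : S → S → Prop} (hP : ∀ x ∈ A, ∀ y ∈ A, P x y ↔ P (θ x) (θ y))
    {p q : S × Option (Fin 4)} (hp : p ∈ cyclePoints A θ) (hq : q ∈ cyclePoints A θ) {i : Fin 4}
    (hip : InPiece i p.2) (hiq : InPiece i q.2) :
    cycleRel θ P p q ↔ P (unfoldPiece θ i p) (unfoldPiece θ i q) := by
  refine ⟨?_, fun h => ⟨i, hip, hiq, h⟩⟩
  rintro ⟨j, hjp, hjq, h⟩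
  rcases inPiece_pair i j with rfl | rfl | rfl | hij
  · exact h
  · obtain ⟨h1, h1'⟩ := unfoldPiece_succ hp hip hjp
    obtain ⟨h2, h2'⟩ := unfoldPiece_succ hq hiq hjq
    rw [h1, h2, ← hP _ h1' _ h2']
    exact h
  · obtain ⟨h1, h1'⟩ := unfoldPiece_succ hp hjp hip
    obtain ⟨h2, h2'⟩ := unfoldPiece_succ hq hjq hiq
    rw [h1, h2, ← hP _ h1' _ h2'] at h
    exact h
  · have h1 := hij _ hip hjp
    have h2 := hij _ hiq hjq
    simpa [unfoldPiece, h1, h2] using h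

theorem cycleRel.exists_piece {P : S → S → Prop} {p q : S × Option (Fin 4)}
    (h : cycleRel θ P p q) : ∃ i, InPiece i p.2 ∧ InPiece i q.2 :=
  h.imp fun _ hi => ⟨hi.1, hi.2.1⟩

theorem unfoldPiece_injOn (hinj : Set.InjOn θ A) (hA : ∀ x ∈ A, θ x ∈ A → θ x = x) {i : Fin 4}
    {p q : S × Option (Fin 4)} (hp : p ∈ cyclePoints A θ) (hq : q ∈ cyclePoints A θ)
    (hip : InPiece i p.2) (hiq : InPiece i q.2)
    (h : unfoldPiece θ i p = unfoldPiece θ i q) : p = q := by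
  obtain ⟨x, τ⟩ := p
  obtain ⟨y, ρ⟩ := q
  have hi : i ≠ i + 1 := (fin_four_ne i).1
  have hxA : x ∈ A := hp.1
  have hyA : y ∈ A := hq.1
  have hp2 : τ = none ↔ θ x = x := hp.2
  have hq2 : ρ = none ↔ θ y = y := hq.2
  have hx := hA x hxA
  have hy := hA y hyA
  have hxy : θ x = θ y → x = y := fun h => hinj hxA hyA h
  rcases hip with hτ | hτ | hτ <;> rcases hiq with hρ | hρ | hρ <;>
    change τ = _ at hτ <;> change ρ = _ at hρ <;> subst hτ <;> subst hρ <;>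
    simp only [unfoldPiece, Option.some.injEq, hi, if_true, if_false, reduceCtorEq] at h hp2 hq2 <;>
    grind

end Cycle

theorem isOGGraph_cycle {S : Type*} {κ : Bool → S} {O G : S → Prop} {R E : Bool → S → S → Prop}
    (h : IsOGGraph κ O G R E) {A : Set S} {θ : S → S} (hκA : ∀ β, κ β ∈ A)
    (hκ : ∀ β, θ (κ β) = κ β)
    (hO : ∀ x ∈ A, O x ↔ O (θ x)) (hG : ∀ x ∈ A, G x ↔ G (θ x))
    (hR : ∀ β, ∀ x ∈ A, ∀ y ∈ A, R β x y ↔ R β (θ x) (θ y))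
    (hE : ∀ β, ∀ x ∈ A, ∀ y ∈ A, E β x y ↔ E β (θ x) (θ y)) :
    IsOGGraph (S := cyclePoints A θ) (fun β => ⟨(κ β, none), hκA β, by simp [hκ]⟩)
      (fun p => O p.1.1) (fun p => G p.1.1) (fun β p q => cycleRel θ (R β) p.1 q.1)
      fun β p q => cycleRel θ (E β) p.1 q.1 := by
  have hOu : ∀ (p : cyclePoints A θ) i, O (unfoldPiece θ i p.1) ↔ O p.1.1 := by
    intro p i
    unfold unfoldPiece
    split_ifs
    · exact (hO _ p.2.1).symm
    · rfl
  have hGu : ∀ (p : cyclePoints A θ) i, G (unfoldPiece θ i p.1) ↔ G p.1.1 := by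
    intro p i
    unfold unfoldPiece
    split_ifs
    · exact (hG _ p.2.1).symm
    · rfl
  constructor
  · intro he
    exact h.const_ne (congrArg (fun p : cyclePoints A θ => p.1.1) he)
  · intro p
    rcases h.cover p.1.1 with hp | hp | ⟨β, hβ⟩
    · exact Or.inl hp
    · exact Or.inr (Or.inl hp)
    · refine Or.inr (Or.inr ⟨β, Subtype.ext (Prod.ext hβ (p.2.2.2 ?_))⟩)
      rw [hβ, hκ]
  · exact fun p => h.not_O_and_G _
  · exact fun β => h.not_O_const β
  · exact fun β => h.not_G_const β
  · rintro β p q ⟨i, hp, hq, hpq⟩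
    exact ⟨(hGu p i).1 (h.sort_R _ _ _ hpq).1, (hGu q i).1 (h.sort_R _ _ _ hpq).2⟩
  · rintro β p q ⟨i, hp, hq, hpq⟩
    exact ⟨(hOu p i).1 (h.sort_E _ _ _ hpq).1, (hGu q i).1 (h.sort_E _ _ _ hpq).2⟩
  · rintro β p q ⟨i, hp, hq, hpq⟩
    exact ⟨i, hq, hp, h.symm_R _ _ _ hpq⟩
  · rintro β p ⟨i, -, -, hp⟩
    exact h.irrefl_R _ _ hp
  · rintro p q ⟨⟨i, hp, hq, hpq⟩, hpq'⟩
    exact h.disjoint_R _ _ ⟨hpq, (cycleRel_iff (hR true) p.2 q.2 hp hq).1 hpq'⟩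
  · intro β o v w hvw hov how
    obtain ⟨i, ho, hv, hw⟩ := exists_common_piece _ _ _ hov.exists_piece how.exists_piece
      hvw.exists_piece
    exact h.no_triangle β _ _ _ ((cycleRel_iff (hR β) v.2 w.2 hv hw).1 hvw)
      ((cycleRel_iff (hE β) o.2 v.2 ho hv).1 hov) ((cycleRel_iff (hE β) o.2 w.2 ho hw).1 how)

section Limit

variable {FM : Type w} [LOG'.Structure FM] [Countable FM]

/-- A partial isomorphism `θ` of the Fraïssé limit of `𝒦` with finite domain `A`, moving every
element of `A` which it does not fix out of `A`, can be closed up to a cycle of length four. -/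
theorem exists_cycle (hlim : IsFraisseLimit KOG FM) {A : Set FM} (hfin : A.Finite) {θ : FM → FM}
    (hκA : ∀ β, ogConst β ∈ A) (hκ : ∀ β, θ (ogConst β) = ogConst β) (hinj : Set.InjOn θ A)
    (hA : ∀ x ∈ A, θ x ∈ A → θ x = x) (hO : ∀ x ∈ A, sortO' x ↔ sortO' (θ x))
    (hG : ∀ x ∈ A, sortG' x ↔ sortG' (θ x))
    (hR : ∀ β, ∀ x ∈ A, ∀ y ∈ A,
      relR' x y (ogConst β) ↔ relR' (θ x) (θ y) (ogConst β))
    (hE : ∀ β, ∀ x ∈ A, ∀ y ∈ A,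
      relE' x y (ogConst β) ↔ relE' (θ x) (θ y) (ogConst β)) :
    ∃ c : Fin 4 → A → FM, ∀ i, ∃ σ : FM ≃[LOG'] FM, ∀ x : A,
      σ x = c i x ∧ σ (θ x) = c (i + 1) x := by
  classical
  have hgraph := (ogAxioms_of_isFraisseLimit hlim).isOGGraph
  have hcycle := isOGGraph_cycle hgraph hκA hκ hO hG hR hE
  have hDfin : Finite (cyclePoints A θ) :=
    ((hfin.prod Set.finite_univ).subset fun p hp => ⟨hp.1, Set.mem_univ _⟩).to_subtype
  have := hfin.to_subtype
  obtain ⟨e, he, heκ, heO, heG, heR, heE⟩ := exists_realization hlim hcycle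
  let t : Fin 4 → A → cyclePoints A θ := fun i x =>
    ⟨(x, if θ x = x then none else some i), x.2, by split_ifs with h <;> simp [h]⟩
  refine ⟨fun i x => e (t i x), fun i => ?_⟩
  have hne : i ≠ i + 1 := (fin_four_ne i).1
  let u : A ⊕ A → FM := Sum.elim (fun x => x) fun x => θ x
  let d : A ⊕ A → cyclePoints A θ := Sum.elim (t i) (t (i + 1))
  have hd : ∀ p, InPiece i (d p).1.2 := by
    rintro (x | x) <;> simp only [d, t, Sum.elim_inl, Sum.elim_inr, InPiece] <;>
      split_ifs <;> simp
  have hu : ∀ p, unfoldPiece θ i (d p).1 = u p := by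
    rintro (x | x) <;> by_cases hx : θ x = (x : FM) <;>
      simp [d, t, u, unfoldPiece, hx, hne]
  have hdO : ∀ p, sortO' (u p) ↔ sortO' (d p).1.1 := by
    rintro (x | x)
    · rfl
    · exact (hO x x.2).symm
  have hdG : ∀ p, sortG' (u p) ↔ sortG' (d p).1.1 := by
    rintro (x | x)
    · rfl
    · exact (hG x x.2).symm
  have htκ : ∀ β, e (t i ⟨ogConst β, hκA β⟩) = ogConst β := by
    intro β
    have ht : t i ⟨ogConst β, hκA β⟩ = ⟨(ogConst β, none), hκA β, by simp [hκ]⟩ := by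
      simp [t, hκ]
    rw [ht, heκ]
  obtain ⟨σ, hσ⟩ := exists_automorphism hlim u (fun p => e (d p))
    (fun β => ⟨Sum.inl ⟨ogConst β, hκA β⟩, rfl, htκ β⟩)
    (fun p q => by
      rw [he.eq_iff, ← hu p, ← hu q]
      exact ⟨fun h => Subtype.ext (unfoldPiece_injOn hinj hA (d p).2 (d q).2 (hd p) (hd q) h),
        fun h => by rw [h]⟩)
    (fun p => (hdO p).trans (heO _).symm) (fun p => (hdG p).trans (heG _).symm)
    (fun β p q => by
      rw [heR, cycleRel_iff (hR β) (d p).2 (d q).2 (hd p) (hd q), hu, hu])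
    (fun β p q => by
      rw [heE, cycleRel_iff (hE β) (d p).2 (d q).2 (hd p) (hd q), hu, hu])
  exact ⟨σ, fun x => ⟨hσ (Sum.inl x), hσ (Sum.inr x)⟩⟩

end Limit

/-! ### The strong order properties of `T_OG` -/

section StrongOrder

variable {FM : Type w} [LOG'.Structure FM] [Countable FM]

/-- An `𝓛`-formula with arbitrarily long finite chains in the Fraïssé limit of `𝒦` has a cycle of
length four there. -/
theorem exists_four_cycle (hlim : IsFraisseLimit KOG FM) [LOG.Structure FM]
    [redOG.IsExpansionOn FM] {k : ℕ} (φ : LOG.Formula (Fin k ⊕ Fin k))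
    (h : ∀ n : ℕ, ∃ a : Fin n → Fin k → FM,
      ∀ i j, i < j → φ.Realize (Sum.elim (a i) (a j))) :
    ∃ c : Fin 4 → Fin k → FM, ∀ i, φ.Realize (Sum.elim (c i) (c (i + 1))) := by
  classical
  let I := Fin k ⊕ Bool
  let γ := ((I → Prop) × (I → Prop) × (I → I → Prop) × (Bool → I → I → Prop) ×
    (Bool → I → I → Prop)) × (I → I → Prop)
  have := Fintype.ofFinite γ
  obtain ⟨n, hn⟩ := exists_monochromatic_triangle (γ := γ) (Fintype.card γ)
  obtain ⟨a₀, ha₀⟩ := h n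
  let a : Fin n → I → FM := fun i => Sum.elim (a₀ i) ogConst
  let col : Fin n → Fin n → γ := fun i j =>
    ((fun s => sortO' (a i s), fun s => sortG' (a i s), fun s t => a i s = a i t,
      fun β s t => relR' (a i s) (a i t) (ogConst β),
      fun β s t => relE' (a i s) (a i t) (ogConst β)), fun s t => a i s = a j t)
  obtain ⟨i, j, l, hij, hjl, h1, h2⟩ := hn Finset.univ Finset.univ col le_rfl (by simp)
    (fun _ _ _ _ _ => Finset.mem_univ _)
  have hO : ∀ s, sortO' (a i s) ↔ sortO' (a j s) := fun s =>
    iff_of_eq (congrFun (congrArg (fun x : γ => x.1.1) h2) s)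
  have hG : ∀ s, sortG' (a i s) ↔ sortG' (a j s) := fun s =>
    iff_of_eq (congrFun (congrArg (fun x : γ => x.1.2.1) h2) s)
  have heq : ∀ s t, a i s = a i t ↔ a j s = a j t := fun s t =>
    iff_of_eq (congrFun₂ (congrArg (fun x : γ => x.1.2.2.1) h2) s t)
  have hR : ∀ β s t, relR' (a i s) (a i t) (ogConst β) ↔ relR' (a j s) (a j t) (ogConst β) :=
    fun β s t => iff_of_eq (congrFun₃ (congrArg (fun x : γ => x.1.2.2.2.1) h2) β s t)
  have hE : ∀ β s t, relE' (a i s) (a i t) (ogConst β) ↔ relE' (a j s) (a j t) (ogConst β) :=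
    fun β s t => iff_of_eq (congrFun₃ (congrArg (fun x : γ => x.1.2.2.2.2) h2) β s t)
  have hil : ∀ s t, a i s = a j t ↔ a i s = a l t := fun s t =>
    iff_of_eq (congrFun₂ (congrArg Prod.snd h1) s t)
  have hjl' : ∀ s t, a i s = a j t ↔ a j s = a l t := fun s t =>
    iff_of_eq (congrFun₂ (congrArg Prod.snd h2) s t)
  have hfix : ∀ s t, a i s = a j t → a i s = a i t := by
    intro s t hst
    refine (heq s t).2 ?_
    rw [← hst, (hil s t).1 hst, (hjl' s t).1 hst]
  let θ : FM → FM := fun x => if hx : ∃ s, a i s = x then a j hx.choose else x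
  have hθ : ∀ s, θ (a i s) = a j s := by
    intro s
    have hs : ∃ t, a i t = a i s := ⟨s, rfl⟩
    simp only [θ, dif_pos hs]
    exact (heq _ _).1 hs.choose_spec
  have hconst : ∀ m β, a m (Sum.inr β) = ogConst β := fun m β => rfl
  obtain ⟨c, hcyc⟩ := exists_cycle hlim (A := Set.range (a i)) (Set.finite_range _) (θ := θ)
    (fun β => ⟨Sum.inr β, rfl⟩)
    (fun β => by rw [← hconst i β, hθ]; rfl)
    (by
      rintro _ ⟨s, rfl⟩ _ ⟨t, rfl⟩ hst
      rw [hθ, hθ] at hst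
      exact (heq s t).2 hst)
    (by
      rintro _ ⟨s, rfl⟩ ⟨t, ht⟩
      rw [hθ] at ht ⊢
      rw [← ht]
      exact hfix t s ht)
    (by rintro _ ⟨s, rfl⟩; rw [hθ]; exact hO s)
    (by rintro _ ⟨s, rfl⟩; rw [hθ]; exact hG s)
    (by rintro β _ ⟨s, rfl⟩ _ ⟨t, rfl⟩; rw [hθ, hθ]; exact hR β s t)
    (by rintro β _ ⟨s, rfl⟩ _ ⟨t, rfl⟩; rw [hθ, hθ]; exact hE β s t)
  refine ⟨fun m s => c m ⟨a i (Sum.inl s), Sum.inl s, rfl⟩, fun m => ?_⟩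
  obtain ⟨σ, hσ⟩ := hcyc m
  have hmap : Sum.elim (fun s => c m ⟨a i (Sum.inl s), Sum.inl s, rfl⟩)
      (fun s => c (m + 1) ⟨a i (Sum.inl s), Sum.inl s, rfl⟩) =
      σ ∘ Sum.elim (a₀ i) (a₀ j) := by
    funext s
    rcases s with s | s
    · exact (hσ ⟨a i (Sum.inl s), Sum.inl s, rfl⟩).1.symm
    · refine (hσ ⟨a i (Sum.inl s), Sum.inl s, rfl⟩).2.symm.trans (congrArg σ ?_)
      exact hθ (Sum.inl s)
  have := ha₀ i j hij
  rw [← LHom.realize_onFormula redOG] at this ⊢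
  rw [hmap, StrongHomClass.realize_formula]
  exact this

/-- The formula `ψ(o, v, w, c; o', v', w', c')` witnessing `SOP₃`: the two tuples have the same
last coordinate `c`, and `R(v', w, c)`, `E(o, w', c)`, `E(o', v, c)` hold. -/
noncomputable def sopFormula : LOG.Formula (Fin 4 ⊕ Fin 4) :=
  let x (s : Fin 4) : LOG.Term (Fin 4 ⊕ Fin 4) := Term.var (Sum.inl s)
  let y (s : Fin 4) : LOG.Term (Fin 4 ⊕ Fin 4) := Term.var (Sum.inr s)
  Term.equal (x 3) (y 3) ⊓ (Relations.formula (L := LOG) RelOG.R ![y 1, x 2, x 3] ⊓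
    (Relations.formula (L := LOG) RelOG.E ![x 0, y 2, x 3] ⊓
      Relations.formula (L := LOG) RelOG.E ![y 0, x 1, x 3]))

theorem realize_sopFormula {S : Type*} [LOG.Structure S] (a b : Fin 4 → S) :
    sopFormula.Realize (Sum.elim a b) ↔ a 3 = b 3 ∧ relR (b 1) (a 2) (a 3) ∧
      relE (a 0) (b 2) (a 3) ∧ relE (b 0) (a 1) (a 3) := by
  have hcomp : ∀ t₁ t₂ t₃ : Fin 4 ⊕ Fin 4,
      (fun i => Term.realize (L := LOG) (Sum.elim a b)
        ((![Term.var t₁, Term.var t₂, Term.var t₃] : Fin 3 → LOG.Term (Fin 4 ⊕ Fin 4)) i)) =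
      ![Sum.elim a b t₁, Sum.elim a b t₂, Sum.elim a b t₃] := by
    intro t₁ t₂ t₃
    funext i
    fin_cases i <;> rfl
  simp only [sopFormula, Formula.realize_inf, Formula.realize_equal, Formula.realize_rel, hcomp,
    Term.realize_var, Sum.elim_inl, Sum.elim_inr, relR, relE]

theorem relR_iff_relR' {S : Type*} [LOG'.Structure S] [LOG.Structure S]
    [redOG.IsExpansionOn S] (x y z : S) : relR x y z ↔ relR' x y z :=
  iff_of_eq (LHom.map_onRelation redOG RelOG.R ![x, y, z]).symm

theorem relE_iff_relE' {S : Type*} [LOG'.Structure S] [LOG.Structure S]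
    [redOG.IsExpansionOn S] (x y z : S) : relE x y z ↔ relE' x y z :=
  iff_of_eq (LHom.map_onRelation redOG RelOG.E ![x, y, z]).symm

theorem not_exists_three_cycle (hlim : IsFraisseLimit KOG FM) [LOG.Structure FM]
    [redOG.IsExpansionOn FM] :
    ¬∃ c : Fin 3 → Fin 4 → FM, ∀ i, sopFormula.Realize (Sum.elim (c i) (c (i + 1))) := by
  rintro ⟨c, hc⟩
  simp only [realize_sopFormula, relR_iff_relR', relE_iff_relE'] at hc
  obtain ⟨h01, -, h0, -⟩ := hc 0
  obtain ⟨h12, h1, -, -⟩ := hc 1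
  obtain ⟨-, -, -, h2⟩ := hc 2
  have hax := ogAxioms_of_isFraisseLimit hlim
  change c 0 3 = c 1 3 at h01
  change c 1 3 = c 2 3 at h12
  rw [h01] at h0
  rw [← h12] at h2
  exact hax.2.2.2.2.2.2.2.2.2.2.2 _ _ _ h1 ⟨_, h2, h0⟩

/-- The points of a finite structure containing a chain of length `n` for `sopFormula`. -/
inductive ChainPoint (n : ℕ) : Type w
  | const (β : Bool)
  | obj (i : Fin n)
  | left (i : Fin n)
  | right (i : Fin n)

namespace ChainPoint

instance (n : ℕ) : Finite (ChainPoint n) :=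
  Finite.of_surjective
    (Sum.elim const (Sum.elim obj (Sum.elim left right)) :
      Bool ⊕ Fin n ⊕ Fin n ⊕ Fin n → ChainPoint n) (by
    rintro (β | i | i | i)
    · exact ⟨Sum.inl β, rfl⟩
    · exact ⟨Sum.inr (Sum.inl i), rfl⟩
    · exact ⟨Sum.inr (Sum.inr (Sum.inl i)), rfl⟩
    · exact ⟨Sum.inr (Sum.inr (Sum.inr i)), rfl⟩)

variable {n : ℕ}

/-- The points of sort `O` of the chain structure. -/
def IsObj : ChainPoint n → Prop
  | obj _ => True
  | _ => False

/-- The points of sort `G` of the chain structure. -/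
def IsVertex : ChainPoint n → Prop
  | left _ => True
  | right _ => True
  | _ => False

/-- The edges of the chain structure: the `j`-th left vertex is adjacent to the `i`-th right
vertex when `i < j`. -/
def Edge (β : Bool) : ChainPoint n → ChainPoint n → Prop
  | left j, right i => β = false ∧ i < j
  | right i, left j => β = false ∧ i < j
  | _, _ => False

/-- The `k`-th object of the chain structure is incident to the left vertices before `k` and to
the right vertices after `k`. -/
def Incident (β : Bool) : ChainPoint n → ChainPoint n → Prop
  | obj k, left j => β = false ∧ j < k
  | obj k, right j => β = false ∧ k < j
  | _, _ => False

theorem isOGGraph (n : ℕ) :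
    IsOGGraph (const : Bool → ChainPoint n) IsObj IsVertex Edge Incident := by
  constructor
  · simp
  · rintro (β | i | i | i) <;> simp [IsObj, IsVertex]
  · rintro (β | i | i | i) <;> simp [IsObj, IsVertex]
  · simp [IsObj]
  · simp [IsVertex]
  · rintro β (_ | _ | _ | _) (_ | _ | _ | _) <;> simp [IsVertex, Edge]
  · rintro β (_ | _ | _ | _) (_ | _ | _ | _) <;> simp [IsObj, IsVertex, Incident]
  · rintro β (_ | _ | _ | _) (_ | _ | _ | _) <;> simp [Edge]
  · rintro β (_ | _ | _ | _) <;> simp [Edge]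
  · rintro (_ | _ | _ | _) (_ | _ | _ | _) <;> simp [Edge]
  · rintro β (_ | k | _ | _) (_ | _ | i | i) (_ | _ | j | j) <;> simp only [Edge, Incident] <;>
      grind

end ChainPoint

theorem exists_finite_sopChain (hlim : IsFraisseLimit KOG FM) [LOG.Structure FM]
    [redOG.IsExpansionOn FM] (n : ℕ) :
    ∃ a : Fin n → Fin 4 → FM, ∀ i j, i < j → sopFormula.Realize (Sum.elim (a i) (a j)) := by
  obtain ⟨e, -, -, -, -, hR, hE⟩ := exists_realization hlim (ChainPoint.isOGGraph.{w} n)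
  refine ⟨fun i => ![e (.obj i), e (.left i), e (.right i), ogConst false], fun i j hij => ?_⟩
  rw [realize_sopFormula]
  simp only [relR_iff_relR', relE_iff_relE']
  exact ⟨rfl, (hR false (.left j) (.right i)).2 ⟨rfl, hij⟩,
    (hE false (.obj i) (.right j)).2 ⟨rfl, hij⟩, (hE false (.obj j) (.left i)).2 ⟨rfl, hij⟩⟩

end StrongOrder

/-- The theory `T_OG` has `SOP₃` and is `NSOP₄`. -/
theorem TOG_SOP3_and_NSOP4
    (M' : Type w) [LOG'.Structure M'] [Countable M']
    (hlim : IsFraisseLimit KOG M')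
    (N : Type w) [LOG.Structure N] [(TOG M').Model N]
    (κ : Cardinal.{w}) (hN : IsMonster LOG N κ) :
    HasSOP LOG N 3 ∧ ¬HasSOP LOG N 4 := by
  let _ : LOG.Structure M' := redOG.reduct M'
  have htransfer : ∀ σ : LOG.Sentence, N ⊨ σ ↔ M' ⊨ σ := by
    have : N ⊨ LOG.completeTheory M' := ‹(TOG M').Model N›
    exact fun σ => realize_iff_of_model_completeTheory M' N σ
  have hcycle : ∀ (m : ℕ) [NeZero m] {k : ℕ} (φ : LOG.Formula (Fin k ⊕ Fin k)),
      (∃ c : Fin m → Fin k → N, ∀ i, φ.Realize (Sum.elim (c i) (c (i + 1)))) ↔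
        ∃ c : Fin m → Fin k → M', ∀ i, φ.Realize (Sum.elim (c i) (c (i + 1))) := by
    intro m _ k φ
    simpa only [forall_eq'] using
      exists_pattern_iff htransfer φ (fun i j : Fin m => i + 1 = j)
  refine ⟨⟨4, sopFormula, hN.exists_chain sopFormula fun n => ?_, ?_⟩, ?_⟩
  · exact (exists_pattern_iff htransfer sopFormula _).2 (exists_finite_sopChain hlim n)
  · rw [hcycle]
    exact not_exists_three_cycle hlim
  · rintro ⟨k, φ, ⟨a, ha⟩, hφ⟩
    refine hφ ((hcycle 4 φ).2 (exists_four_cycle hlim φ fun n => ?_))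
    exact (exists_pattern_iff htransfer φ _).1 ⟨fun i => a i, fun i j hij => ha i j hij⟩

end PaperDiv
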